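/- arXiv:1808.09061 — 2 statements merged into one kernel-verified Lean document; each statement's English description precedes it below -/
import Mathlib

section
/- There exists a subgroup G ≤ W isomorphic to the Frobenius group of order 42 (the semidirect product C₇ ⋊ C₆ with C₆ acting faithfully on C₇) such that: the action of G on the 56 exceptional classes has exactly two orbits, of lengths 14 and 42; G is minimal; G fixes no conic class; and G satisfies condition (H1). -/
open scoped BigOperators

noncomputable section

/-- The Picard lattice of a degree 2 del Pezzo surface. -/
abbrev V : Type := Fin 8 → ℤ

/-- The intersection form. -/
def bil (x y : V) : ℤ := x 0 * y 0 - ∑ i ∈ Finset.Ioi (0 : Fin 8), x i * y i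

/-- The canonical class. -/
def Kvec : V := fun i => if i = 0 then -3 else 1

abbrev LatAut := V ≃ₗ[ℤ] V

/-- The Weyl group: automorphisms preserving the form and fixing K. -/
def W : Subgroup LatAut where
  carrier := {g | (∀ x y, bil (g x) (g y) = bil x y) ∧ g Kvec = Kvec}
  one_mem' := ⟨fun _ _ => rfl, rfl⟩
  mul_mem' := by
    rintro a b ⟨ha1, ha2⟩ ⟨hb1, hb2⟩
    refine ⟨fun x y => ?_, ?_⟩
    · show bil (a (b x)) (a (b y)) = bil x y
      rw [ha1, hb1]
    · show a (b Kvec) = Kvec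
      rw [hb2, ha2]
  inv_mem' := by
    rintro a ⟨ha1, ha2⟩
    refine ⟨fun x y => ?_, ?_⟩
    · have h := ha1 (a⁻¹ x) (a⁻¹ y)
      have hx : a (a⁻¹ x) = x := a.apply_symm_apply x
      have hy : a (a⁻¹ y) = y := a.apply_symm_apply y
      rw [hx, hy] at h
      exact h.symm
    · have h2 : a.symm (a Kvec) = a.symm Kvec := by rw [ha2]
      rw [a.symm_apply_apply] at h2
      exact (show a⁻¹ Kvec = a.symm Kvec from rfl).trans h2.symm

/-- Exceptional classes. -/
def Exc : Set V := {E | bil E E = -1 ∧ bil E Kvec = -1}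

/-- Conic classes. -/
def IsConic (C : V) : Prop := bil C C = 0 ∧ bil C Kvec = -2

/-- The orbit of a vector under a subgroup of `LatAut`. -/
def orb (G : Subgroup LatAut) (E : V) : Set V := {v | ∃ g ∈ G, g E = v}

/-- The set of orbits of exceptional classes. -/
def orbs (G : Subgroup LatAut) : Set (Set V) := {S | ∃ E ∈ Exc, S = orb G E}

/-- The stabilizer of a vector, as a subgroup of `LatAut`. -/
def stab (G : Subgroup LatAut) (E : V) : Subgroup LatAut where
  carrier := {g | g ∈ G ∧ g E = E}
  one_mem' := ⟨G.one_mem, rfl⟩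
  mul_mem' := by
    rintro a b ⟨haG, ha⟩ ⟨hbG, hb⟩
    exact ⟨G.mul_mem haG hbG, by show a (b E) = E; rw [hb, ha]⟩
  inv_mem' := by
    rintro a ⟨haG, ha⟩
    refine ⟨G.inv_mem haG, ?_⟩
    conv_lhs => rw [← ha]
    exact a.symm_apply_apply E

/-- `G` is minimal: no nonempty orbit of exceptional classes consists of pairwise
orthogonal classes. -/
def MinimalAction (G : Subgroup LatAut) : Prop :=
  ∀ E ∈ Exc, ¬ (∀ E₁ ∈ orb G E, ∀ E₂ ∈ orb G E, E₁ ≠ E₂ → bil E₁ E₂ = 0)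

/-- The natural representation of a subgroup of `LatAut` on the lattice. -/
def rep (G : Subgroup LatAut) : Representation ℤ G V where
  toFun g := (g : LatAut).toLinearMap
  map_one' := rfl
  map_mul' _ _ := rfl

/-- Condition (H1): the first group cohomology of every subgroup of `G`
with coefficients in the lattice vanishes. -/
def CondH1 (G : Subgroup LatAut) : Prop :=
  ∀ G' : Subgroup LatAut, G' ≤ G →
    Subsingleton (groupCohomology.H1 (Rep.of (rep G')))

theorem bil_eq_sum (x y : V) : bil x y = x 0 * y 0 - ∑ i : Fin 7, x i.succ * y i.succ := by
  rw [bil, Fin.sum_Ioi_zero]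

theorem bil_comm (x y : V) : bil x y = bil y x := by
  simp only [bil_eq_sum, mul_comm]

theorem bil_add_left (x y z : V) : bil (x + y) z = bil x z + bil y z := by
  simp only [bil_eq_sum, Pi.add_apply, add_mul, Finset.sum_add_distrib]
  ring

theorem bil_smul_left (c : ℤ) (x y : V) : bil (c • x) y = c * bil x y := by
  simp only [bil_eq_sum, Pi.smul_apply, smul_eq_mul, mul_assoc, ← Finset.mul_sum]
  ring

theorem bil_sub_left (x y z : V) : bil (x - y) z = bil x z - bil y z := by
  have h := bil_add_left (x - y) y z
  rw [sub_add_cancel] at h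
  linarith

theorem bil_smul_right (c : ℤ) (x y : V) : bil x (c • y) = c * bil x y := by
  rw [bil_comm, bil_smul_left, bil_comm]

theorem bil_sub_right (x y z : V) : bil x (y - z) = bil x y - bil x z := by
  rw [bil_comm, bil_sub_left, bil_comm y, bil_comm z]

theorem bil_Kvec_Kvec : bil Kvec Kvec = 2 := by decide

/-! ### Vanishing of `H¹` -/

/-- A 1-cocycle of a finite group acting isometrically on the lattice is a coboundary as soon as
the lattice is an equivariant retract of a permutation module; the retraction is encoded by a
stable finite set of pairs `(a, b)` with `x = ∑ ⟨x, a⟩ b` for every `x`. -/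
theorem exists_eq_sub_of_cocycle {H : Subgroup LatAut} [Finite H] (hH : H ≤ W)
    (S : Finset (V × V)) (hS : ∀ g ∈ H, ∀ p ∈ S, (g p.1, g p.2) ∈ S)
    (hid : ∀ x, ∑ p ∈ S, bil x p.1 • p.2 = x)
    (f : H → V) (hf : ∀ g h : H, f (g * h) = (g : LatAut) (f h) + f g) :
    ∃ v : V, ∀ g : H, f g = (g : LatAut) v - v := by
  have := Fintype.ofFinite H
  set n : ℤ := (Fintype.card H : ℤ) with hn
  have hn0 : n ≠ 0 := by simp [hn]
  set u : V := ∑ h, f h with hu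
  have hgu (g : H) : (g : LatAut) u = u - n • f g := by
    have h1 : ∑ h, f (g * h) = u := Fintype.sum_equiv (Equiv.mulLeft g) _ _ fun _ => rfl
    simp only [hf, Finset.sum_add_distrib, Finset.sum_const, Finset.card_univ, ← map_sum] at h1
    rw [← hu, ← natCast_zsmul, ← hn] at h1
    exact eq_sub_of_add_eq h1
  refine ⟨-∑ p ∈ S, (bil u p.1 / n) • p.2, fun g => ?_⟩
  have hdiv (p : V × V) :
      bil u p.1 / n = bil u ((g : LatAut) p.1) / n - bil (f g) ((g : LatAut) p.1) := by
    rw [← (hH g.2).1 u p.1, hgu, bil_sub_left, bil_smul_left, sub_eq_add_neg, ← mul_neg,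
      Int.add_mul_ediv_left _ _ hn0, sub_eq_add_neg]
  have hinj : Function.Injective fun p : V × V => ((g : LatAut) p.1, (g : LatAut) p.2) :=
    (g : LatAut).injective.prodMap (g : LatAut).injective
  have himg : S.image (fun p => ((g : LatAut) p.1, (g : LatAut) p.2)) = S :=
    Finset.eq_of_subset_of_card_le
      (Finset.image_subset_iff.2 fun p hp => hS g g.2 p hp)
      (Finset.card_image_of_injective S hinj).ge
  have key : (g : LatAut) (∑ p ∈ S, (bil u p.1 / n) • p.2) =
      ∑ p ∈ S, (bil u p.1 / n - bil (f g) p.1) • p.2 := by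
    conv_rhs => rw [← himg]
    rw [Finset.sum_image fun _ _ _ _ h => hinj h, map_sum]
    exact Finset.sum_congr rfl fun p _ => by rw [map_zsmul, hdiv]
  rw [map_neg, key]
  simp only [sub_smul, Finset.sum_sub_distrib, hid]
  abel

theorem condH1_of_retract {G : Subgroup LatAut} [Finite G] (hG : G ≤ W)
    (S : Finset (V × V)) (hS : ∀ g ∈ G, ∀ p ∈ S, (g p.1, g p.2) ∈ S)
    (hid : ∀ x, ∑ p ∈ S, bil x p.1 • p.2 = x) : CondH1 G := by
  intro H hHG
  have : Finite H := Finite.of_injective _ (Subgroup.inclusion_injective hHG)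
  refine ⟨fun x y => ?_⟩
  suffices h : ∀ z : groupCohomology.H1 (Rep.of (rep H)), z = 0 by rw [h x, h y]
  refine fun z => groupCohomology.H1_induction_on z fun f => ?_
  obtain ⟨v, hv⟩ := exists_eq_sub_of_cocycle (hHG.trans hG) S (fun g hg => hS g (hHG hg)) hid f
    fun g h => (groupCohomology.mem_cocycles₁_iff _).1 f.2 g h
  exact (groupCohomology.H1π_eq_zero_iff f).2 ⟨v, funext fun g => (hv g).symm⟩

/-! ### The Geiser involution and coordinate permutations -/

/-- The Geiser involution, acting as `-1` on the orthogonal complement of the canonical class. -/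
def geiser : LatAut :=
  LinearEquiv.ofInvolutive
    { toFun := fun x => bil x Kvec • Kvec - x
      map_add' := fun x y => by rw [bil_add_left, add_smul]; abel
      map_smul' := fun c x => by
        rw [bil_smul_left, mul_smul, RingHom.id_apply, smul_sub] }
    fun x => by
      change bil (bil x Kvec • Kvec - x) Kvec • Kvec - (bil x Kvec • Kvec - x) = x
      rw [bil_sub_left, bil_smul_left, bil_Kvec_Kvec, mul_two, add_sub_cancel_right,
        sub_sub_cancel]

theorem geiser_apply (x : V) : geiser x = bil x Kvec • Kvec - x := rfl

theorem geiser_sq : geiser ^ 2 = 1 := by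
  rw [sq]
  exact LinearEquiv.ext geiser.symm_apply_apply

theorem geiser_mem_W : geiser ∈ W := by
  refine ⟨fun x y => ?_, ?_⟩
  · simp only [geiser_apply, bil_sub_left, bil_sub_right, bil_smul_left, bil_smul_right,
      bil_Kvec_Kvec, bil_comm Kvec y]
    ring
  · rw [geiser_apply, bil_Kvec_Kvec, two_smul, add_sub_cancel_right]

/-- Permutations of the seven blown-up points acting on the lattice. -/
def permAut : Equiv.Perm (Fin 7) →* LatAut where
  toFun σ :=
    { toFun := fun x => Fin.cons (x 0) fun i => x (σ⁻¹ i).succ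
      invFun := fun x => Fin.cons (x 0) fun i => x (σ i).succ
      map_add' := fun x y => funext fun i => by cases i using Fin.cases <;> rfl
      map_smul' := fun c x => funext fun i => by cases i using Fin.cases <;> rfl
      left_inv := fun x => funext fun i => by cases i using Fin.cases <;> simp
      right_inv := fun x => funext fun i => by cases i using Fin.cases <;> simp }
  map_one' := LinearEquiv.ext fun x => funext fun i => by cases i using Fin.cases <;> rfl
  map_mul' σ τ := LinearEquiv.ext fun x => funext fun i => by cases i using Fin.cases <;> rfl

theorem permAut_apply (σ : Equiv.Perm (Fin 7)) (x : V) :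
    permAut σ x = Fin.cons (x 0) fun i => x (σ⁻¹ i).succ := rfl

theorem permAut_mem_W (σ : Equiv.Perm (Fin 7)) : permAut σ ∈ W := by
  refine ⟨fun x y => ?_, funext fun i => by cases i using Fin.cases <;> rfl⟩
  simp only [bil_eq_sum, permAut_apply, Fin.cons_zero, Fin.cons_succ]
  rw [Equiv.sum_comp σ⁻¹ fun i => x i.succ * y i.succ]

theorem geiser_commute {g : LatAut} (hg : g ∈ W) : Commute geiser g := by
  refine LinearEquiv.ext fun x => ?_
  change geiser (g x) = g (geiser x)
  have h := hg.1 x Kvec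
  rw [hg.2] at h
  rw [geiser_apply, geiser_apply, map_sub, map_zsmul, hg.2, h]

/-! ### The Frobenius group of order 42 -/

theorem three_pow_val_add (k l : ZMod 6) :
    (3 : ZMod 7) ^ (k + l).val = 3 ^ k.val * 3 ^ l.val := by
  revert k l; decide

theorem three_pow_mul_five_pow (k : ZMod 6) : (3 : ZMod 7) ^ k.val * 5 ^ k.val = 1 := by
  revert k; decide

theorem five_pow_mul_three_pow (k : ZMod 6) : (5 : ZMod 7) ^ k.val * 3 ^ k.val = 1 := by
  rw [mul_comm, three_pow_mul_five_pow]

/-- The faithful action of `C₆` on `C₇`, the generator acting as multiplication by `3`. -/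
def frobeniusAction : Multiplicative (ZMod 6) →* MulAut (Multiplicative (ZMod 7)) where
  toFun k :=
    { toFun := fun a => .ofAdd (3 ^ k.toAdd.val * a.toAdd)
      invFun := fun a => .ofAdd (5 ^ k.toAdd.val * a.toAdd)
      left_inv := fun a => by simp [← mul_assoc, five_pow_mul_three_pow]
      right_inv := fun a => by simp [← mul_assoc, three_pow_mul_five_pow]
      map_mul' := fun a b => by simp [mul_add] }
  map_one' := MulEquiv.ext fun a => by
    change Multiplicative.ofAdd (3 ^ (0 : ZMod 6).val * a.toAdd) = a
    simp
  map_mul' k l := MulEquiv.ext fun a => by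
    change Multiplicative.ofAdd (3 ^ (k.toAdd + l.toAdd).val * a.toAdd) =
      .ofAdd (3 ^ k.toAdd.val * (3 ^ l.toAdd.val * a.toAdd))
    rw [three_pow_val_add, mul_assoc]

theorem frobeniusAction_injective : Function.Injective frobeniusAction := by
  intro k l h
  have h1 : (3 : ZMod 7) ^ k.toAdd.val * 1 = 3 ^ l.toAdd.val * 1 :=
    congrArg (fun e : MulAut _ => (e (.ofAdd 1)).toAdd) h
  have h2 : ∀ k l : ZMod 6, (3 : ZMod 7) ^ k.val * 1 = 3 ^ l.val * 1 → k = l := by decide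
  exact h2 _ _ h1

/-- The Frobenius group of order 42. -/
abbrev F42 : Type := Multiplicative (ZMod 7) ⋊[frobeniusAction] Multiplicative (ZMod 6)

/-- The affine permutation `i ↦ 3 ^ k * i + a` of `ZMod 7`. -/
def affinePerm (a : ZMod 7) (k : ZMod 6) : Equiv.Perm (Fin 7) where
  toFun := fun i : ZMod 7 => (3 ^ k.val * i + a : ZMod 7)
  invFun := fun i : ZMod 7 => (5 ^ k.val * (i - a) : ZMod 7)
  left_inv := fun i : ZMod 7 => by
    change 5 ^ k.val * (3 ^ k.val * i + a - a) = i
    rw [add_sub_cancel_right, ← mul_assoc, five_pow_mul_three_pow, one_mul]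
  right_inv := fun i : ZMod 7 => by
    change 3 ^ k.val * (5 ^ k.val * (i - a)) + a = i
    rw [← mul_assoc, three_pow_mul_five_pow, one_mul, sub_add_cancel]

/-- The action of `F42` on the seven points. -/
def toPerm : F42 →* Equiv.Perm (Fin 7) where
  toFun g := affinePerm g.left.toAdd g.right.toAdd
  map_one' := Equiv.ext (α := ZMod 7) fun i => by
    change 3 ^ (0 : ZMod 6).val * i + 0 = i
    simp
  map_mul' g h := Equiv.ext (α := ZMod 7) fun i => by
    change 3 ^ (g.right.toAdd + h.right.toAdd).val * i +
        (g.left.toAdd + 3 ^ g.right.toAdd.val * h.left.toAdd) =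
      3 ^ g.right.toAdd.val * (3 ^ h.right.toAdd.val * i + h.left.toAdd) + g.left.toAdd
    rw [three_pow_val_add]
    ring

theorem geiser_pow_val_add (k l : ZMod 6) :
    geiser ^ (k + l).val = geiser ^ k.val * geiser ^ l.val := by
  have h : ∀ k l : ZMod 6, (k + l).val % 2 = (k.val + l.val) % 2 := by decide
  rw [← pow_add, pow_eq_pow_mod _ geiser_sq, h, ← pow_eq_pow_mod _ geiser_sq]

/-- The representation of `F42` on the lattice: odd permutations of the seven points are
composed with the Geiser involution. -/
def toAut : F42 →* LatAut where
  toFun g := geiser ^ g.right.toAdd.val * permAut (toPerm g)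
  map_one' := by
    change geiser ^ (0 : ZMod 6).val * _ = _
    simp
  map_mul' g h := by
    change geiser ^ (g.right.toAdd + h.right.toAdd).val * _ = _
    rw [geiser_pow_val_add, map_mul, map_mul]
    exact Commute.mul_mul_mul_comm
      ((geiser_commute (permAut_mem_W _)).pow_left _) _ _

/-- An explicit formula for `toAut`. -/
def act (a : ZMod 7) (k : ZMod 6) (x : V) : V :=
  if k.val % 2 = 0 then permAut (affinePerm a k) x else geiser (permAut (affinePerm a k) x)

theorem toAut_apply (g : F42) (x : V) :
    toAut g x = act g.left.toAdd g.right.toAdd x := by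
  change (geiser ^ g.right.toAdd.val * permAut (toPerm g)) x = _
  rw [act, pow_eq_pow_mod _ geiser_sq]
  split_ifs with h
  · rw [h, pow_zero, one_mul]; rfl
  · rw [Nat.mod_two_ne_zero.1 h, pow_one]; rfl

theorem toAut_range_le_W : toAut.range ≤ W := by
  rintro _ ⟨g, rfl⟩
  exact W.mul_mem (W.pow_mem geiser_mem_W _) (permAut_mem_W _)

theorem act_mem_range (a : ZMod 7) (k : ZMod 6) :
    ∃ g ∈ toAut.range, ∀ x, g x = act a k x :=
  ⟨_, ⟨⟨.ofAdd a, .ofAdd k⟩, rfl⟩, toAut_apply _⟩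

theorem exists_act_of_mem_range {g : LatAut} (hg : g ∈ toAut.range) :
    ∃ a k, ∀ x, g x = act a k x := by
  obtain ⟨g, rfl⟩ := hg
  exact ⟨_, _, toAut_apply g⟩

/-- The class of the exceptional curve over the first blown-up point. -/
def pointClass : V := ![0, 1, 0, 0, 0, 0, 0, 0]

/-- The class of the line through the first two blown-up points. -/
def lineClass : V := ![1, -1, -1, 0, 0, 0, 0, 0]

theorem toAut_injective : Function.Injective toAut := by
  rw [injective_iff_map_eq_one]
  intro g hg
  have h : ∀ a k, act a k lineClass = lineClass → a = 0 ∧ k = 0 := by decide +kernel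
  obtain ⟨h1, h2⟩ := h _ _ (by rw [← toAut_apply, hg]; rfl)
  exact SemidirectProduct.ext h1 h2

instance : Finite F42 := Finite.of_equiv _ SemidirectProduct.equivProd.symm

/-! ### Orbits -/

/-- The orbit of a vector under `F42` as a finite set. -/
def orbFinset (x : V) : Finset V :=
  (Finset.univ : Finset (ZMod 7 × ZMod 6)).image fun p => act p.1 p.2 x

theorem orb_range (x : V) : orb toAut.range x = orbFinset x := by
  ext v
  simp only [orbFinset, Finset.coe_image, Finset.coe_univ, Set.image_univ, Set.mem_range,
    Prod.exists]
  constructor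
  · rintro ⟨g, hg, rfl⟩
    obtain ⟨a, k, h⟩ := exists_act_of_mem_range hg
    exact ⟨a, k, (h x).symm⟩
  · rintro ⟨a, k, rfl⟩
    obtain ⟨g, hg, h⟩ := act_mem_range a k
    exact ⟨g, hg, h x⟩

theorem orb_eq_of_mem {G : Subgroup LatAut} {x y : V} (h : y ∈ orb G x) : orb G y = orb G x := by
  obtain ⟨g, hg, rfl⟩ := h
  ext v
  constructor
  · rintro ⟨k, hk, rfl⟩
    exact ⟨k * g, G.mul_mem hk hg, rfl⟩
  · rintro ⟨k, hk, rfl⟩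
    exact ⟨k * g⁻¹, G.mul_mem hk (G.inv_mem hg), congrArg k (g.symm_apply_apply x)⟩

theorem ncard_orb_pointClass : (orb toAut.range pointClass).ncard = 14 := by
  rw [orb_range, Set.ncard_coe_finset]
  decide +kernel

theorem ncard_orb_lineClass : (orb toAut.range lineClass).ncard = 42 := by
  rw [orb_range, Set.ncard_coe_finset]
  decide +kernel

/-- The coordinates of an exceptional class take at most two consecutive values besides the
degree, which lies between `0` and `3`. -/
theorem exists_coordinates_of_mem_Exc {E : V} (hE : E ∈ Exc) :
    ∃ d c : Fin 4, (d, c) ∈ ([(0, 0), (1, 1), (2, 1), (3, 2)] : List (Fin 4 × Fin 4)) ∧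
      E 0 = d.val ∧ ∀ i : Fin 7, E i.succ = -(c.val : ℤ) ∨ E i.succ = 1 - c.val := by
  obtain ⟨h1, h2⟩ := hE
  simp only [bil_eq_sum, Kvec, Fin.succ_ne_zero, if_true, if_false, mul_one] at h1 h2
  have hcs : (∑ i : Fin 7, E i.succ) ^ 2 ≤ 7 * ∑ i : Fin 7, E i.succ ^ 2 := by
    simpa using sq_sum_le_card_mul_sum_sq (s := Finset.univ) (f := fun i : Fin 7 => E i.succ)
  have hsq : ∑ i : Fin 7, E i.succ ^ 2 = E 0 ^ 2 + 1 := by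
    simp only [sq]; linarith
  have hsum : ∑ i : Fin 7, E i.succ = 1 - 3 * E 0 := by linarith
  rw [hsq, hsum] at hcs
  have hlo : 0 ≤ E 0 := by nlinarith
  have hhi : E 0 ≤ 3 := by nlinarith
  have hcoord (c : ℤ) (hc : E 0 ^ 2 + 1 + (2 * c - 1) * (1 - 3 * E 0) + 7 * (c * (c - 1)) = 0)
      (i : Fin 7) : E i.succ = -c ∨ E i.succ = 1 - c := by
    have hexp : ∑ i : Fin 7, (E i.succ + c) * (E i.succ + c - 1) = 0 := by
      rw [← hc, ← hsq, ← hsum, Finset.mul_sum, ← Finset.sum_add_distrib]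
      rw [show 7 * (c * (c - 1)) = ∑ _i : Fin 7, c * (c - 1) by simp, ← Finset.sum_add_distrib]
      exact Finset.sum_congr rfl fun i _ => by ring
    have hnn (i : Fin 7) : 0 ≤ (E i.succ + c) * (E i.succ + c - 1) := by
      rcases le_or_gt (E i.succ + c) 0 with h | h
      · exact mul_nonneg_of_nonpos_of_nonpos h (by linarith)
      · exact mul_nonneg h.le (by linarith [Int.add_one_le_iff.2 h])
    have h0 := (Finset.sum_eq_zero_iff_of_nonneg fun i _ => hnn i).1 hexp i (Finset.mem_univ i)
    rcases mul_eq_zero.1 h0 with h | h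
    · left; linarith
    · right; linarith
  have hd : E 0 = 0 ∨ E 0 = 1 ∨ E 0 = 2 ∨ E 0 = 3 := by omega
  rcases hd with h | h | h | h
  · exact ⟨0, 0, by decide, h, hcoord 0 (by rw [h]; norm_num)⟩
  · exact ⟨1, 1, by decide, h, hcoord 1 (by rw [h]; norm_num)⟩
  · exact ⟨2, 1, by decide, h, hcoord 1 (by rw [h]; norm_num)⟩
  · exact ⟨3, 2, by decide, h, hcoord 2 (by rw [h]; norm_num)⟩

/-- The vector of degree `d` with remaining coordinates `-c` or `1 - c`. -/
def twoValued (d c : Fin 4) (e₁ e₂ e₃ e₄ e₅ e₆ e₇ : Bool) : V :=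
  ![d.val, e₁.toInt - c.val, e₂.toInt - c.val, e₃.toInt - c.val, e₄.toInt - c.val,
    e₅.toInt - c.val, e₆.toInt - c.val, e₇.toInt - c.val]

theorem mem_orb_of_mem_Exc {E : V} (hE : E ∈ Exc) :
    E ∈ orb toAut.range pointClass ∨ E ∈ orb toAut.range lineClass := by
  obtain ⟨d, c, hdc, h0, hi⟩ := exists_coordinates_of_mem_Exc hE
  have hb (i : Fin 7) : ∃ b : Bool, E i.succ = b.toInt - c.val := by
    rcases hi i with h | h
    · exact ⟨false, by simp [h]⟩
    · exact ⟨true, by simp [h]⟩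
  choose e he using hb
  have hEe : E = twoValued d c (e 0) (e 1) (e 2) (e 3) (e 4) (e 5) (e 6) := by
    funext i
    cases i using Fin.cases with
    | zero => exact h0
    | succ i => rw [he]; fin_cases i <;> rfl
  have key : ∀ p ∈ ([(0, 0), (1, 1), (2, 1), (3, 2)] : List (Fin 4 × Fin 4)),
      ∀ e₁ e₂ e₃ e₄ e₅ e₆ e₇, bil (twoValued p.1 p.2 e₁ e₂ e₃ e₄ e₅ e₆ e₇) Kvec = -1 →
        twoValued p.1 p.2 e₁ e₂ e₃ e₄ e₅ e₆ e₇ ∈ orbFinset pointClass ∨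
        twoValued p.1 p.2 e₁ e₂ e₃ e₄ e₅ e₆ e₇ ∈ orbFinset lineClass := by
    decide +kernel
  rw [orb_range, orb_range, Finset.mem_coe, Finset.mem_coe, hEe]
  exact key _ hdc _ _ _ _ _ _ _ (hEe ▸ hE.2)

theorem pointClass_mem_Exc : pointClass ∈ Exc := by
  constructor <;> decide

theorem lineClass_mem_Exc : lineClass ∈ Exc := by
  constructor <;> decide

theorem orbs_range :
    orbs toAut.range = {orb toAut.range pointClass, orb toAut.range lineClass} := by
  ext S
  constructor
  · rintro ⟨E, hE, rfl⟩
    exact (mem_orb_of_mem_Exc hE).imp orb_eq_of_mem orb_eq_of_mem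
  · rintro (rfl | rfl)
    · exact ⟨_, pointClass_mem_Exc, rfl⟩
    · exact ⟨_, lineClass_mem_Exc, rfl⟩

theorem orb_pointClass_ne_orb_lineClass :
    orb toAut.range pointClass ≠ orb toAut.range lineClass := fun h => by
  have h14 := ncard_orb_pointClass
  rw [h, ncard_orb_lineClass] at h14
  omega

theorem setOf_orbs_ncard_eq_fourteen :
    {S ∈ orbs toAut.range | S.ncard = 14} = {orb toAut.range pointClass} := by
  ext S
  rw [orbs_range]
  constructor
  · rintro ⟨rfl | rfl, h⟩
    · rfl
    · rw [ncard_orb_lineClass] at h; omega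
  · rintro rfl
    exact ⟨.inl rfl, ncard_orb_pointClass⟩

theorem setOf_orbs_ncard_eq_fortyTwo :
    {S ∈ orbs toAut.range | S.ncard = 42} = {orb toAut.range lineClass} := by
  ext S
  rw [orbs_range]
  constructor
  · rintro ⟨rfl | rfl, h⟩
    · rw [ncard_orb_pointClass] at h; omega
    · rfl
  · rintro rfl
    exact ⟨.inr rfl, ncard_orb_lineClass⟩

theorem minimalAction_range : MinimalAction toAut.range := by
  intro E hE horth
  have key : ∀ F ∈ ({pointClass, lineClass} : Finset V), ∃ v ∈ orbFinset F, ∃ w ∈ orbFinset F,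
      v ≠ w ∧ bil v w ≠ 0 := by
    decide +kernel
  have hF : ∃ F ∈ ({pointClass, lineClass} : Finset V), orb toAut.range E = orbFinset F := by
    rcases mem_orb_of_mem_Exc hE with h | h
    · exact ⟨pointClass, by simp, (orb_eq_of_mem h).trans (orb_range _)⟩
    · exact ⟨lineClass, by simp, (orb_eq_of_mem h).trans (orb_range _)⟩
  obtain ⟨F, hF, horb⟩ := hF
  obtain ⟨v, hv, w, hw, hne, hvw⟩ := key F hF
  exact hvw (horth v (horb ▸ hv) w (horb ▸ hw) hne)

/-! ### Fixed conic classes -/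

theorem not_exists_fixed_conic : ¬ ∃ C, IsConic C ∧ ∀ g ∈ toAut.range, g C = C := by
  rintro ⟨C, ⟨hC1, hC2⟩, hfix⟩
  have hact (a k) : act a k C = C := by
    obtain ⟨g, hg, h⟩ := act_mem_range a k
    rw [← h, hfix g hg]
  have htrans (a : ZMod 7) : permAut (affinePerm a 0) C = C := hact a 0
  have hconst (i : Fin 7) : C i.succ = C 1 := by
    have h := congrFun (htrans i) i.succ
    rw [permAut_apply, Fin.cons_succ] at h
    have h0 : ∀ i : Fin 7, (affinePerm i 0)⁻¹ i = 0 := by decide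
    rw [← h, h0]
    rfl
  have hperm : permAut (affinePerm 0 3) C = C := by
    funext i
    cases i using Fin.cases with
    | zero => rfl
    | succ i => rw [permAut_apply, Fin.cons_succ, hconst, hconst]
  have hodd : geiser (permAut (affinePerm 0 3) C) = C := hact 0 3
  rw [hperm, geiser_apply, hC2] at hodd
  have hCK : C = -Kvec := by
    funext i
    have h := congrFun hodd i
    simp only [Pi.sub_apply, Pi.smul_apply, smul_eq_mul] at h
    rw [Pi.neg_apply]
    omega
  have h2 : bil (-Kvec) (-Kvec) = 2 := by decide
  rw [hCK, h2] at hC1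
  omega

/-! ### The permutation module -/

/-- The orbit of a pair of vectors under `F42`. -/
def pairOrbit (x y : V) : Finset (V × V) :=
  (Finset.univ : Finset (ZMod 7 × ZMod 6)).image fun p => (act p.1 p.2 x, act p.1 p.2 y)

theorem apply_mem_pairOrbit {g : LatAut} (hg : g ∈ toAut.range) {x y : V} {p : V × V}
    (hp : p ∈ pairOrbit x y) : (g p.1, g p.2) ∈ pairOrbit x y := by
  simp only [pairOrbit, Finset.mem_image, Finset.mem_univ, true_and, Prod.exists] at hp ⊢
  obtain ⟨a, k, rfl⟩ := hp
  obtain ⟨h, hh, hact⟩ := act_mem_range a k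
  obtain ⟨b, l, hgh⟩ := exists_act_of_mem_range (toAut.range.mul_mem hg hh)
  refine ⟨b, l, ?_⟩
  simp only [← hgh, ← hact]
  rfl

/-- Pairs exhibiting the lattice as a retract of a permutation module of rank 17. The second
vector attached to `pointClass` is supported on the quadratic residues modulo 7. -/
def retractPairs : Finset (V × V) :=
  pairOrbit pointClass ![0, 0, 1, 1, 0, 1, 0, 0] ∪
    (pairOrbit ![1, 0, 0, 0, 0, 0, 0, 0] ![-4, 0, 0, 0, 0, 0, 0, 0] ∪
      pairOrbit Kvec (8 • Kvec))

theorem sum_bil_smul_eq_self (S : Finset (V × V))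
    (hS : ∀ i : Fin 8, ∑ p ∈ S, bil (Pi.single i 1) p.1 • p.2 = Pi.single i 1) (x : V) :
    ∑ p ∈ S, bil x p.1 • p.2 = x := by
  let T : V →ₗ[ℤ] V :=
    { toFun := fun x => ∑ p ∈ S, bil x p.1 • p.2
      map_add' := fun x y => by simp only [bil_add_left, add_smul, Finset.sum_add_distrib]
      map_smul' := fun c x => by
        simp only [bil_smul_left, mul_smul, Finset.smul_sum, RingHom.id_apply] }
  have hT : T = LinearMap.id := (Pi.basisFun ℤ (Fin 8)).ext fun i => by
    rw [Pi.basisFun_apply]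
    exact hS i
  exact LinearMap.congr_fun hT x

theorem sum_retractPairs (x : V) : ∑ p ∈ retractPairs, bil x p.1 • p.2 = x :=
  sum_bil_smul_eq_self retractPairs (by decide +kernel) x

theorem condH1_range : CondH1 toAut.range := by
  have : Finite toAut.range := Set.finite_range toAut
  refine condH1_of_retract toAut_range_le_W retractPairs (fun g hg p hp => ?_) sum_retractPairs
  simp only [retractPairs, Finset.mem_union] at hp ⊢
  exact hp.imp (apply_mem_pairOrbit hg)
    (Or.imp (apply_mem_pairOrbit hg) (apply_mem_pairOrbit hg))

theorem exists_dp2_F7 :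
    ∃ G : Subgroup LatAut, G ≤ W ∧
      (∃ φ : Multiplicative (ZMod 6) →* MulAut (Multiplicative (ZMod 7)),
      Function.Injective φ ∧
      Nonempty (G ≃* Multiplicative (ZMod 7) ⋊[φ] Multiplicative (ZMod 6))) ∧
      (orbs G).ncard = 2 ∧
      {S ∈ orbs G | S.ncard = 14}.ncard = 1 ∧
      {S ∈ orbs G | S.ncard = 42}.ncard = 1 ∧
      MinimalAction G ∧
      (¬ ∃ C, IsConic C ∧ ∀ g ∈ G, g C = C) ∧
      CondH1 G := by
  refine ⟨toAut.range, toAut_range_le_W, ⟨frobeniusAction, frobeniusAction_injective,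
    ⟨(MonoidHom.ofInjective toAut_injective).symm⟩⟩, ?_, ?_, ?_, minimalAction_range,
    not_exists_fixed_conic, condH1_range⟩
  · rw [orbs_range, Set.ncard_pair orb_pointClass_ne_orb_lineClass]
  · rw [setOf_orbs_ncard_eq_fourteen, Set.ncard_singleton]
  · rw [setOf_orbs_ncard_eq_fortyTwo, Set.ncard_singleton]

end
end

section
/- There exists a subgroup G ≤ W isomorphic to the dihedral group of order 12 such that: the action of G on the 56 exceptional classes has exactly six orbits, of lengths 2, 6, 12, 12, 12, 12, with point stabilizers cyclic of order 6 for the orbit of length 2, cyclic of order 2 for the orbit of length 6, and trivial for the four orbits of length 12; G is minimal; G fixes a conic class; and G satisfies condition (H1). -/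
open scoped BigOperators

noncomputable section

/-! ### Cocycles with values in direct summands of permutation modules -/

/-- `k` times a cocycle is a coboundary as soon as multiplication by `k` factors equivariantly
through a permutation module `X → ℤ`. -/
lemma exists_smul_cocycle_eq_coboundary {Γ M X : Type*} [Group Γ] [Finite Γ] [AddCommGroup M]
    (τ : Representation ℤ Γ M) (ι : M →ₗ[ℤ] X → ℤ) (π : (X → ℤ) →ₗ[ℤ] M) (σ : Γ → X → X)
    (hι : ∀ g x, ι (τ g x) = ι x ∘ σ g) (hπ : ∀ g y, π (y ∘ σ g) = τ g (π y))
    (k : ℤ) (hk : ∀ x, π (ι x) = k • x)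
    (f : Γ → M) (hf : ∀ g h, f (g * h) = τ g (f h) + f g) :
    ∃ v, ∀ g, k • f g = τ g v - v := by
  classical
  have := Fintype.ofFinite Γ
  set N : ℤ := (Fintype.card Γ : ℤ) with hN
  have hN0 : N ≠ 0 := by simp [hN]
  set u : X → ℤ := ∑ h, ι (f h) with hu
  have key (g : Γ) (i : X) : u i = u (σ g i) + N * ι (f g) i := by
    have h1 : u = ∑ h, ι (f (g * h)) :=
      (Fintype.sum_equiv (Equiv.mulLeft g) _ _ fun _ => rfl).symm
    refine (congrFun h1 i).trans ?_
    simp [hf, hι, hu, Finset.sum_add_distrib, hN]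
  have hdiv (g : Γ) : ι (f g) = (fun i => u i / N) - (fun i => u i / N) ∘ σ g := by
    ext i
    simp [key g i, Int.add_mul_ediv_left _ _ hN0]
  refine ⟨-π fun i => u i / N, fun g => ?_⟩
  rw [← hk, hdiv, map_sub, hπ, map_neg]
  abel

/-- The automorphism `g` acts through a permutation of coordinates along the maps `ι` and `π`. -/
def ActsByPerm {X : Type} (ι : V →ₗ[ℤ] X → ℤ) (π : (X → ℤ) →ₗ[ℤ] V) (g : LatAut) : Prop :=
  ∃ σ : X → X, (∀ x, ι (g x) = ι x ∘ σ) ∧ ∀ y, π (y ∘ σ) = g (π y)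

lemma ActsByPerm.one {X : Type} (ι : V →ₗ[ℤ] X → ℤ) (π : (X → ℤ) →ₗ[ℤ] V) :
    ActsByPerm ι π 1 :=
  ⟨id, fun _ => rfl, fun _ => rfl⟩

lemma ActsByPerm.mul {X : Type} {ι : V →ₗ[ℤ] X → ℤ} {π : (X → ℤ) →ₗ[ℤ] V} {g h : LatAut}
    (hg : ActsByPerm ι π g) (hh : ActsByPerm ι π h) : ActsByPerm ι π (g * h) := by
  obtain ⟨σ, hσ, hσ'⟩ := hg
  obtain ⟨τ, hτ, hτ'⟩ := hh
  refine ⟨τ ∘ σ, fun x => ?_, fun y => ?_⟩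
  · rw [LinearEquiv.mul_apply, hσ, hτ, Function.comp_assoc]
  · rw [LinearEquiv.mul_apply, ← hτ', ← hσ', Function.comp_assoc]

/-- If multiplication by `2` and by `3` on the lattice both factor through permutation modules,
then condition (H1) holds. -/
lemma condH1_of_actsByPerm {G : Subgroup LatAut} [Finite G] {X Y : Type}
    {ι₂ : V →ₗ[ℤ] X → ℤ} {π₂ : (X → ℤ) →ₗ[ℤ] V} {ι₃ : V →ₗ[ℤ] Y → ℤ} {π₃ : (Y → ℤ) →ₗ[ℤ] V}
    (h₂ : ∀ x, π₂ (ι₂ x) = (2 : ℤ) • x) (h₃ : ∀ x, π₃ (ι₃ x) = (3 : ℤ) • x)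
    (hG₂ : ∀ g ∈ G, ActsByPerm ι₂ π₂ g) (hG₃ : ∀ g ∈ G, ActsByPerm ι₃ π₃ g) : CondH1 G := by
  intro G' hG'
  have : Finite G' := Finite.of_injective _ (Subgroup.inclusion_injective hG')
  refine subsingleton_of_forall_eq 0 fun x => ?_
  induction x using groupCohomology.H1_induction_on with | _ f
  rw [groupCohomology.H1π_eq_zero_iff]
  have hf := (groupCohomology.mem_cocycles₁_iff _).1 f.2
  choose σ₂ hσ₂ hσ₂' using fun g : G' => hG₂ g (hG' g.2)
  choose σ₃ hσ₃ hσ₃' using fun g : G' => hG₃ g (hG' g.2)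
  obtain ⟨v, hv⟩ := exists_smul_cocycle_eq_coboundary (rep G') ι₂ π₂ σ₂ hσ₂ hσ₂' 2 h₂ f hf
  obtain ⟨w, hw⟩ := exists_smul_cocycle_eq_coboundary (rep G') ι₃ π₃ σ₃ hσ₃ hσ₃' 3 h₃ f hf
  refine ⟨w - v, funext fun g => ?_⟩
  have h : (f g : V) = (3 : ℤ) • (f g : V) - (2 : ℤ) • (f g : V) := by
    rw [← sub_smul]; norm_num
  refine Eq.trans ?_ h.symm
  rw [hv, hw]
  change rep G' g (w - v) - (w - v) = _
  rw [map_sub]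
  abel

/-! ### Homomorphisms out of dihedral groups -/

/-- The homomorphism from a dihedral group given by a pair satisfying its defining relations. -/
def dihedralLift {H : Type*} [Group H] {n : ℕ} [NeZero n] (a b : H) (ha : a ^ n = 1)
    (hb : b * b = 1) (hab : b * a * b = a⁻¹) : DihedralGroup n →* H :=
  have hadd (i j : ZMod n) : a ^ (i + j).val = a ^ i.val * a ^ j.val := by
    rw [ZMod.val_add, ← pow_add]
    exact (pow_eq_pow_mod _ ha).symm
  have hsub (i j : ZMod n) : a ^ (j - i).val = (a ^ i.val)⁻¹ * a ^ j.val := by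
    rw [eq_inv_mul_iff_mul_eq, ← hadd, add_sub_cancel]
  have hconj (k : ℕ) : a ^ k * b = b * (a ^ k)⁻¹ := by
    have hb' : b⁻¹ = b := inv_eq_of_mul_eq_one_left hb
    have h : (b * a * b⁻¹) ^ k = (a⁻¹) ^ k := by rw [hb', hab]
    rw [conj_pow, inv_pow, hb'] at h
    rw [← h, ← mul_assoc, ← mul_assoc, hb, one_mul]
  { toFun := fun
      | .r k => a ^ k.val
      | .sr k => b * a ^ k.val
    map_one' := by
      change a ^ (0 : ZMod n).val = 1
      simp
    map_mul' := by
      rintro (i | i) (j | j)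
      · exact hadd i j
      · change b * a ^ (j - i).val = a ^ i.val * (b * a ^ j.val)
        rw [hsub, ← mul_assoc, ← mul_assoc, hconj]
      · change b * a ^ (i + j).val = b * a ^ i.val * a ^ j.val
        rw [hadd, mul_assoc]
      · change a ^ (j - i).val = b * a ^ i.val * (b * a ^ j.val)
        rw [hsub, mul_assoc, ← mul_assoc (a ^ i.val), hconj, ← mul_assoc, ← mul_assoc, hb,
          one_mul] }

lemma dihedralLift_induction {H : Type*} [Group H] {n : ℕ} [NeZero n] {a b : H} (ha : a ^ n = 1)
    (hb : b * b = 1) (hab : b * a * b = a⁻¹) {P : H → Prop} (h1 : P 1)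
    (hmul : ∀ g h, P g → P h → P (g * h)) (hPa : P a) (hPb : P b) :
    ∀ g ∈ (dihedralLift a b ha hb hab).range, P g := by
  have hpow (k : ℕ) : P (a ^ k) := by
    induction k with
    | zero => simpa using h1
    | succ k ih => simpa [pow_succ] using hmul _ _ ih hPa
  rintro _ ⟨i | i, rfl⟩
  · exact hpow _
  · exact hmul _ _ hPb (hpow _)

/-! ### The dihedral group of automorphisms -/

/-- The index map of the cyclic permutation of the last six coordinates. -/
def rotIdx : Fin 8 → Fin 8 := ![0, 1, 7, 2, 3, 4, 5, 6]

/-- The inverse of `rotIdx`. -/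
def rotIdxInv : Fin 8 → Fin 8 := ![0, 1, 3, 4, 5, 6, 7, 2]

/-- The automorphism cyclically permuting the last six coordinates. -/
def rot : LatAut :=
  LinearEquiv.funCongrLeft ℤ ℤ ⟨rotIdx, rotIdxInv, by decide, by decide⟩

lemma rot_apply (x : V) : rot x = x ∘ rotIdx := rfl

/-- The vector underlying `fiberFlip x`. -/
def flipVec (x : V) : V :=
  ![4 * x 0 + 3 * x 1 + (x 2 + x 3 + x 4 + x 5 + x 6 + x 7),
    -3 * x 0 - 2 * x 1 - (x 2 + x 3 + x 4 + x 5 + x 6 + x 7),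
    -x 0 - x 1 - x 2, -x 0 - x 1 - x 7, -x 0 - x 1 - x 6,
    -x 0 - x 1 - x 5, -x 0 - x 1 - x 4, -x 0 - x 1 - x 3]

lemma flipVec_flipVec (x : V) : flipVec (flipVec x) = x := by
  ext i
  fin_cases i <;> simp [flipVec] <;> ring

/-- The involution swapping the components of the singular fibres of the conic bundle
`(1, -1, 0, …, 0)` in a way that normalizes the cyclic permutation `rot`. -/
def fiberFlip : LatAut where
  toFun := flipVec
  invFun := flipVec
  map_add' x y := by
    ext i
    fin_cases i <;> simp [flipVec] <;> ring
  map_smul' c x := by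
    ext i
    fin_cases i <;> simp [flipVec] <;> ring
  left_inv := flipVec_flipVec
  right_inv := flipVec_flipVec

lemma fiberFlip_apply (x : V) : fiberFlip x = flipVec x := rfl

lemma fiberFlip_mul_self : fiberFlip * fiberFlip = 1 :=
  LinearEquiv.ext flipVec_flipVec

lemma rot_pow_six : rot ^ 6 = 1 := by
  refine LinearEquiv.ext fun x => funext fun i => ?_
  fin_cases i <;> rfl

lemma flipVec_comp_rotIdx (x : V) : flipVec (x ∘ rotIdx) = flipVec x ∘ rotIdxInv := by
  ext i
  fin_cases i <;> simp [flipVec, rotIdx, rotIdxInv] <;> ring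

lemma fiberFlip_mul_rot_mul_fiberFlip : fiberFlip * rot * fiberFlip = rot⁻¹ := by
  refine LinearEquiv.ext fun x => ?_
  change flipVec (flipVec x ∘ rotIdx) = x ∘ rotIdxInv
  rw [flipVec_comp_rotIdx, flipVec_flipVec]

/-- The action of the dihedral group of order 12 on the lattice. -/
def dihedralHom : DihedralGroup 6 →* LatAut :=
  dihedralLift rot fiberFlip rot_pow_six fiberFlip_mul_self fiberFlip_mul_rot_mul_fiberFlip

lemma mem_range_dihedralHom_induction {P : LatAut → Prop} (h1 : P 1)
    (hmul : ∀ g h, P g → P h → P (g * h)) (hrot : P rot) (hflip : P fiberFlip) :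
    ∀ g ∈ dihedralHom.range, P g :=
  dihedralLift_induction _ _ _ h1 hmul hrot hflip

lemma bil_eq (x y : V) : bil x y = x 0 * y 0 - (x 1 * y 1 + x 2 * y 2 + x 3 * y 3 + x 4 * y 4 +
    x 5 * y 5 + x 6 * y 6 + x 7 * y 7) := by
  have h : Finset.Ioi (0 : Fin 8) = {1, 2, 3, 4, 5, 6, 7} := by decide
  simp [bil, h]
  ring

lemma range_dihedralHom_le : dihedralHom.range ≤ W := by
  refine mem_range_dihedralHom_induction W.one_mem (fun _ _ => W.mul_mem) ⟨fun x y => ?_, ?_⟩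
    ⟨fun x y => ?_, ?_⟩
  · simp [bil_eq, rot_apply, rotIdx]
    ring
  · decide +kernel
  · simp [bil_eq, fiberFlip_apply, flipVec]
    ring
  · decide +kernel

instance : Finite dihedralHom.range :=
  Set.finite_range dihedralHom

lemma exists_conic_fixed :
    ∃ C, IsConic C ∧ ∀ g ∈ dihedralHom.range, g C = C := by
  refine ⟨![1, -1, 0, 0, 0, 0, 0, 0], ⟨by decide +kernel, by decide +kernel⟩,
    mem_range_dihedralHom_induction rfl (fun g h hg hh => ?_) ?_ ?_⟩
  · rw [LinearEquiv.mul_apply, hh, hg]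
  · decide +kernel
  · decide +kernel

/-! ### Condition (H1) -/

/-- The embedding of the lattice into the module coinduced from the cyclic subgroup. -/
def coindMap : V →ₗ[ℤ] Fin 8 ⊕ Fin 8 → ℤ where
  toFun x := Sum.elim x (fiberFlip x)
  map_add' x y := by ext (i | i) <;> simp
  map_smul' c x := by
    ext (i | i)
    · rfl
    · exact congrFun (map_smul fiberFlip c x) i

/-- The corestriction from the module coinduced from the cyclic subgroup. -/
def coresMap : (Fin 8 ⊕ Fin 8 → ℤ) →ₗ[ℤ] V :=
  LinearMap.funLeft ℤ ℤ Sum.inl + fiberFlip.toLinearMap ∘ₗ LinearMap.funLeft ℤ ℤ Sum.inr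

lemma coresMap_apply (y : Fin 8 ⊕ Fin 8 → ℤ) :
    coresMap y = y ∘ Sum.inl + fiberFlip (y ∘ Sum.inr) := rfl

lemma coresMap_coindMap (x : V) : coresMap (coindMap x) = (2 : ℤ) • x := by
  change x + flipVec (flipVec x) = _
  rw [flipVec_flipVec, two_smul]

lemma actsByPerm_coind : ∀ g ∈ dihedralHom.range, ActsByPerm coindMap coresMap g := by
  refine mem_range_dihedralHom_induction (.one _ _) (fun _ _ => .mul)
    ⟨Sum.map rotIdx rotIdxInv, fun x => ?_, fun y => ?_⟩ ⟨Sum.swap, fun x => ?_, fun y => ?_⟩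
  · ext (i | i)
    · rfl
    · exact congrFun (flipVec_comp_rotIdx x) i
  · rw [coresMap_apply, coresMap_apply, map_add]
    congr 1
    change flipVec ((y ∘ Sum.inr) ∘ rotIdxInv) = flipVec (y ∘ Sum.inr) ∘ rotIdx
    rw [← flipVec_flipVec (flipVec (y ∘ Sum.inr) ∘ rotIdx), flipVec_comp_rotIdx, flipVec_flipVec]
  · ext (i | i)
    · rfl
    · exact congrFun (flipVec_flipVec x) i
  · rw [coresMap_apply, coresMap_apply, map_add, add_comm]
    congr 1
    exact (flipVec_flipVec _).symm

/-- Generators of a permuted sublattice of index 9: the orbits of `(0, 1, 0, …, 0)` and of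
`(1, 0, -1, -1, 0, -1, 0, 0)`. -/
def permBasis : Matrix (Fin 8) (Fin 8) ℤ :=
  !![0, 1, 0, 0, 0, 0, 0, 0;
     3, -2, -1, -1, -1, -1, -1, -1;
     1, 0, -1, -1, 0, -1, 0, 0;
     1, 0, 0, -1, -1, 0, -1, 0;
     1, 0, 0, 0, -1, -1, 0, -1;
     1, 0, -1, 0, 0, -1, -1, 0;
     1, 0, 0, -1, 0, 0, -1, -1;
     1, 0, -1, 0, -1, 0, 0, -1]

/-- Three times the coordinates with respect to `permBasis`. -/
def permCoord : Matrix (Fin 8) (Fin 8) ℤ :=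
  !![6, 3, 2, 2, 2, 2, 2, 2;
     3, 0, 1, 1, 1, 1, 1, 1;
     -1, 0, -1, -2, 0, -1, 1, 0;
     -1, 0, 0, -1, -2, 0, -1, 1;
     -1, 0, 1, 0, -1, -2, 0, -1;
     -1, 0, -1, 1, 0, -1, -2, 0;
     -1, 0, 0, -1, 1, 0, -1, -2;
     -1, 0, -2, 0, -1, 1, 0, -1]

lemma vecMul_permBasis_permCoord (x : V) :
    permBasis.vecMulLinear (permCoord.mulVecLin x) = (3 : ℤ) • x := by
  have h : permBasis.transpose * permCoord = (3 : ℤ) • 1 := by decide +kernel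
  simp only [Matrix.vecMulLinear_apply, Matrix.mulVecLin_apply]
  rw [← Matrix.mulVec_transpose, Matrix.mulVec_mulVec, h, Matrix.smul_mulVec, Matrix.one_mulVec]

lemma linearMap_ext_single {ι M : Type*} [Finite ι] [DecidableEq ι] [AddCommGroup M]
    {f g : (ι → ℤ) →ₗ[ℤ] M} (h : ∀ i, f (Pi.single i 1) = g (Pi.single i 1)) : f = g :=
  (Pi.basisFun ℤ ι).ext fun i => by simpa using h i

lemma actsByPerm_matrix {A B : Matrix (Fin 8) (Fin 8) ℤ} {g : LatAut} (σ : Fin 8 → Fin 8)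
    (hA : ∀ i, A.mulVecLin (g (Pi.single i 1)) = A.mulVecLin (Pi.single i 1) ∘ σ)
    (hB : ∀ i, B.vecMulLinear ((Pi.single i 1 : V) ∘ σ) = g (B.vecMulLinear (Pi.single i 1))) :
    ActsByPerm A.mulVecLin B.vecMulLinear g :=
  ⟨σ, LinearMap.congr_fun (linearMap_ext_single (f := A.mulVecLin ∘ₗ g.toLinearMap)
      (g := LinearMap.funLeft ℤ ℤ σ ∘ₗ A.mulVecLin) hA),
    LinearMap.congr_fun (linearMap_ext_single (f := B.vecMulLinear ∘ₗ LinearMap.funLeft ℤ ℤ σ)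
      (g := g.toLinearMap ∘ₗ B.vecMulLinear) hB)⟩

lemma actsByPerm_permBasis :
    ∀ g ∈ dihedralHom.range, ActsByPerm permCoord.mulVecLin permBasis.vecMulLinear g :=
  mem_range_dihedralHom_induction (.one _ _) (fun _ _ => .mul)
    (actsByPerm_matrix rotIdx (by decide +kernel) (by decide +kernel))
    (actsByPerm_matrix ![1, 0, 3, 2, 7, 6, 5, 4] (by decide +kernel) (by decide +kernel))

lemma condH1_range_dihedralHom : CondH1 dihedralHom.range :=
  condH1_of_actsByPerm coresMap_coindMap vecMul_permBasis_permCoord actsByPerm_coind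
    actsByPerm_permBasis

/-! ### Orbits of exceptional classes -/

/-- Representatives of the orbits of exceptional classes. -/
def excRep : Fin 6 → V :=
  ![![0, 1, 0, 0, 0, 0, 0, 0], ![1, 0, -1, 0, 0, -1, 0, 0], ![0, 0, 1, 0, 0, 0, 0, 0],
    ![1, 0, -1, -1, 0, 0, 0, 0], ![1, 0, -1, 0, -1, 0, 0, 0], ![2, 0, -1, -1, -1, -1, -1, 0]]

/-- The vector with first coordinate `a` whose other coordinates are `c` or `c + 1` according to
the bits `b`, where `c` depends only on `a`; every exceptional class has this form. -/
def excOfBits (a : Fin 4) (b : Fin 7 → Bool) : V :=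
  Matrix.vecCons (a : ℤ) fun i => (![0, -1, -1, -2] a : ℤ) + (b i).toNat

lemma eq_or_eq_add_one_of_sum_eq_zero {ι : Type*} [Fintype ι] {x : ι → ℤ} {c : ℤ}
    (h : ∑ i, (x i - c) * (x i - (c + 1)) = 0) (i : ι) : x i = c ∨ x i = c + 1 := by
  have hnn (n : ℤ) : 0 ≤ (n - c) * (n - (c + 1)) := by
    rcases lt_or_ge c n with hn | hn <;> nlinarith
  have := (Finset.sum_eq_zero_iff_of_nonneg fun j _ => hnn (x j)).1 h i (Finset.mem_univ i)
  rcases mul_eq_zero.1 this with h | h <;> omega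

lemma exists_excOfBits {E : V} (hE : E ∈ Exc) : ∃ a b, E = excOfBits a b := by
  obtain ⟨h1, h2⟩ := hE
  have hsum : ∑ i : Fin 7, E i.succ = 1 - 3 * E 0 := by
    simp [bil_eq, Kvec] at h2
    simp [Fin.sum_univ_seven]
    linarith
  have hsq : ∑ i : Fin 7, E i.succ ^ 2 = E 0 ^ 2 + 1 := by
    simp [bil_eq] at h1
    simp [Fin.sum_univ_seven]
    linarith
  have hcauchy := sq_sum_le_card_mul_sum_sq (s := Finset.univ) (f := fun i : Fin 7 => E i.succ)
  rw [hsum, hsq] at hcauchy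
  simp only [Finset.card_univ, Fintype.card_fin, Nat.cast_ofNat] at hcauchy
  have ha0 : 0 ≤ E 0 := by nlinarith
  have ha3 : E 0 ≤ 3 := by nlinarith
  obtain ⟨a, ha⟩ : ∃ a : Fin 4, E 0 = (a : ℤ) :=
    ⟨⟨(E 0).toNat, by omega⟩, by simp [ha0]⟩
  have hsum₀ : ∑ i : Fin 7, (E i.succ - ![0, -1, -1, -2] a) *
      (E i.succ - ((![0, -1, -1, -2] a : ℤ) + 1)) = 0 := by
    have hexp (c : ℤ) : ∑ i : Fin 7, (E i.succ - c) * (E i.succ - (c + 1)) =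
        ∑ i : Fin 7, E i.succ ^ 2 - (2 * c + 1) * ∑ i : Fin 7, E i.succ + 7 * (c * (c + 1)) := by
      simp only [Fin.sum_univ_seven]
      ring
    rw [hexp, hsum, hsq, ha]
    fin_cases a <;> norm_num
  have hbit := eq_or_eq_add_one_of_sum_eq_zero hsum₀
  refine ⟨a, fun i => decide (E i.succ = (![0, -1, -1, -2] a : ℤ) + 1), ?_⟩
  ext i
  refine Fin.cases ha (fun j => ?_) i
  rcases hbit j with h | h <;> simp [excOfBits, h]

lemma exists_eq_smul_excRep {E : V} (hE : E ∈ Exc) : ∃ i g, E = dihedralHom g (excRep i) := by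
  obtain ⟨a, b, rfl⟩ := exists_excOfBits hE
  have key : ∀ a b, bil (excOfBits a b) (excOfBits a b) = -1 → bil (excOfBits a b) Kvec = -1 →
      ∃ i g, excOfBits a b = dihedralHom g (excRep i) := by
    decide +kernel
  exact key a b hE.1 hE.2

lemma excRep_mem_Exc (i : Fin 6) : excRep i ∈ Exc := by
  have key : ∀ i, bil (excRep i) (excRep i) = -1 ∧ bil (excRep i) Kvec = -1 := by
    decide +kernel
  exact key i

/-- The orbit of `excRep i` as a finite set. -/
def excOrbit (i : Fin 6) : Finset V := Finset.univ.image fun g => dihedralHom g (excRep i)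

lemma orb_excRep (g : DihedralGroup 6) (i : Fin 6) :
    orb dihedralHom.range (dihedralHom g (excRep i)) = excOrbit i := by
  ext v
  simp only [orb, excOrbit, Finset.coe_image, Finset.coe_univ, Set.image_univ, Set.mem_range,
    Set.mem_ofPred_eq, MonoidHom.mem_range, exists_exists_eq_and]
  constructor
  · rintro ⟨h, rfl⟩
    exact ⟨h * g, by rw [map_mul, LinearEquiv.mul_apply]⟩
  · rintro ⟨h, rfl⟩
    exact ⟨h * g⁻¹, by rw [← LinearEquiv.mul_apply, ← map_mul, inv_mul_cancel_right]⟩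

lemma card_excOrbit : ∀ i, (excOrbit i).card = ![2, 6, 12, 12, 12, 12] i := by
  decide +kernel

lemma excOrbit_injective : Function.Injective fun i => (excOrbit i : Set V) := by
  have key : ∀ i j, excRep i ∈ excOrbit j → i = j := by decide +kernel
  intro i j h
  refine key i j ?_
  rw [← Finset.coe_inj.1 h]
  exact Finset.mem_image.2 ⟨1, Finset.mem_univ _, by rw [map_one]; rfl⟩

lemma orbs_eq : orbs dihedralHom.range = Set.range fun i => (excOrbit i : Set V) := by
  ext S
  constructor
  · rintro ⟨E, hE, rfl⟩
    obtain ⟨i, g, rfl⟩ := exists_eq_smul_excRep hE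
    exact ⟨i, (orb_excRep g i).symm⟩
  · rintro ⟨i, rfl⟩
    refine ⟨excRep i, excRep_mem_Exc i, ?_⟩
    simpa using (orb_excRep 1 i).symm

lemma ncard_orbs_ncard_eq (n : ℕ) :
    {S ∈ orbs dihedralHom.range | S.ncard = n}.ncard =
      (Finset.univ.filter fun i : Fin 6 => ![2, 6, 12, 12, 12, 12] i = n).card := by
  rw [← Set.ncard_coe_finset, ← Set.ncard_image_of_injective _ excOrbit_injective, orbs_eq]
  congr 1
  ext S
  simp only [Set.mem_ofPred_eq, Set.mem_range, Set.mem_image, Finset.coe_filter, Finset.mem_univ,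
    true_and]
  constructor
  · rintro ⟨⟨i, rfl⟩, h⟩
    rw [Set.ncard_coe_finset, card_excOrbit] at h
    exact ⟨i, h, rfl⟩
  · rintro ⟨i, h, rfl⟩
    exact ⟨⟨i, rfl⟩, by rw [Set.ncard_coe_finset, card_excOrbit, h]⟩

/-! ### Stabilizers -/

lemma dihedralHom_injective : Function.Injective dihedralHom := by
  have key : ∀ g, dihedralHom g (excRep 2) = excRep 2 → g = 1 := by decide +kernel
  refine (injective_iff_map_eq_one _).2 fun g hg => key g ?_
  rw [hg]
  rfl

/-- The rotation generating the stabilizers of the points of the `i`-th orbit. -/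
def stabRot : Fin 6 → ZMod 6 := ![1, 3, 0, 0, 0, 0]

lemma stab_excRep (g : DihedralGroup 6) (i : Fin 6) :
    stab dihedralHom.range (dihedralHom g (excRep i)) =
      Subgroup.zpowers (dihedralHom (.r (stabRot i))) := by
  have key : ∀ i g h, dihedralHom h (dihedralHom g (excRep i)) = dihedralHom g (excRep i) →
      ∃ k : Fin 6, .r (stabRot i) ^ (k : ℕ) = h := by
    decide +kernel
  have key' : ∀ i g, dihedralHom (.r (stabRot i)) (dihedralHom g (excRep i)) =
      dihedralHom g (excRep i) := by
    decide +kernel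
  apply le_antisymm
  · rintro _ ⟨⟨h, rfl⟩, hfix⟩
    obtain ⟨k, rfl⟩ := key i g h hfix
    rw [map_pow]
    exact Subgroup.npow_mem_zpowers _ _
  · rw [Subgroup.zpowers_le]
    exact ⟨⟨_, rfl⟩, key' i g⟩

lemma stab_of_ncard_orb {E : V} (hE : E ∈ Exc) :
    ((orb dihedralHom.range E).ncard = 2 →
      IsCyclic (stab dihedralHom.range E) ∧ Nat.card (stab dihedralHom.range E) = 6) ∧
    ((orb dihedralHom.range E).ncard = 6 →
      IsCyclic (stab dihedralHom.range E) ∧ Nat.card (stab dihedralHom.range E) = 2) ∧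
    ((orb dihedralHom.range E).ncard = 12 → stab dihedralHom.range E = ⊥) := by
  obtain ⟨i, g, rfl⟩ := exists_eq_smul_excRep hE
  have hcard : Nat.card (stab dihedralHom.range (dihedralHom g (excRep i))) =
      6 / Nat.gcd 6 (stabRot i).val := by
    rw [stab_excRep, Nat.card_zpowers, orderOf_injective _ dihedralHom_injective,
      DihedralGroup.orderOf_r]
  have hcyc : IsCyclic (stab dihedralHom.range (dihedralHom g (excRep i))) := by
    rw [stab_excRep]
    infer_instance
  rw [orb_excRep, Set.ncard_coe_finset, card_excOrbit, ← Subgroup.card_eq_one, hcard]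
  have key : ∀ i, (![2, 6, 12, 12, 12, 12] i = 2 → 6 / Nat.gcd 6 (stabRot i).val = 6) ∧
      (![2, 6, 12, 12, 12, 12] i = 6 → 6 / Nat.gcd 6 (stabRot i).val = 2) ∧
      (![2, 6, 12, 12, 12, 12] i = 12 → 6 / Nat.gcd 6 (stabRot i).val = 1) := by
    decide +kernel
  obtain ⟨h₂, h₆, h₁₂⟩ := key i
  exact ⟨fun h => ⟨hcyc, h₂ h⟩, fun h => ⟨hcyc, h₆ h⟩, h₁₂⟩

lemma minimalAction_range_dihedralHom : MinimalAction dihedralHom.range := by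
  intro E hE hall
  obtain ⟨i, g, rfl⟩ := exists_eq_smul_excRep hE
  rw [orb_excRep] at hall
  have key : ∀ i, ∃ g h, dihedralHom g (excRep i) ≠ dihedralHom h (excRep i) ∧
      bil (dihedralHom g (excRep i)) (dihedralHom h (excRep i)) ≠ 0 := by
    decide +kernel
  obtain ⟨a, b, hne, hb⟩ := key i
  exact hb (hall _ (by simp [excOrbit]) _ (by simp [excOrbit]) hne)

theorem exists_dp2_D6_conic :
    ∃ G : Subgroup LatAut, G ≤ W ∧
      Nonempty (G ≃* DihedralGroup 6) ∧
      (orbs G).ncard = 6 ∧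
      {S ∈ orbs G | S.ncard = 2}.ncard = 1 ∧
      {S ∈ orbs G | S.ncard = 6}.ncard = 1 ∧
      {S ∈ orbs G | S.ncard = 12}.ncard = 4 ∧
      (∀ E ∈ Exc,
        ((orb G E).ncard = 2 → IsCyclic (stab G E) ∧ Nat.card (stab G E) = 6) ∧
        ((orb G E).ncard = 6 → IsCyclic (stab G E) ∧ Nat.card (stab G E) = 2) ∧
        ((orb G E).ncard = 12 → stab G E = ⊥)) ∧
      MinimalAction G ∧
      (∃ C, IsConic C ∧ ∀ g ∈ G, g C = C) ∧
      CondH1 G := by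
  refine ⟨dihedralHom.range, range_dihedralHom_le,
    ⟨(MonoidHom.ofInjective dihedralHom_injective).symm⟩, ?_, ?_, ?_, ?_,
    fun _ => stab_of_ncard_orb, minimalAction_range_dihedralHom, exists_conic_fixed,
    condH1_range_dihedralHom⟩
  · rw [orbs_eq, ← Set.image_univ, Set.ncard_image_of_injective _ excOrbit_injective]
    simp
  all_goals
    rw [ncard_orbs_ncard_eq]
    decide

end
end
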